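/- Let p ∈ (1,∞). Assume conditions (1.2) and (2.1), let u, v be a principal fundamental system of solutions of (r z')' = q z with ρ = u·v, and assume that the Green operator G is a bounded operator on L_p(ℝ). Then G : L_p(ℝ) → L_p(ℝ) is a compact operator if and only if ρ(x) s(x) → 0 as |x| → ∞. -/

import Mathlib

open MeasureTheory Filter Topology
open scoped ENNReal RealInnerProductSpace

noncomputable section

/-- Conditions (1.2): `r, q` measurable, `r > 0`, `q ≥ 0`, with `1/r` and `q`
locally Lebesgue integrable on `ℝ`. -/
def Cond12 (r q : ℝ → ℝ) : Prop :=
  Measurable r ∧ Measurable q ∧ (∀ x, 0 < r x) ∧ (∀ x, 0 ≤ q x) ∧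
    LocallyIntegrable (fun t => 1 / r t) volume ∧ LocallyIntegrable q volume

/-- Condition (1.3): for every `x`,
`(∫_{x-d}^x dt/r(t)) · (∫_{x-d}^x q(t) dt) → ∞` as `|d| → ∞`. -/
def Cond13 (r q : ℝ → ℝ) : Prop :=
  ∀ x : ℝ, Tendsto (fun d : ℝ => (∫ t in x - d..x, 1 / r t) * (∫ t in x - d..x, q t))
    (cocompact ℝ) atTop

/-- Condition (2.1): `∫_{-∞}^x q > 0` and `∫_x^∞ q > 0` for every `x`. -/
def Cond21 (q : ℝ → ℝ) : Prop :=
  ∀ x : ℝ, 0 < ∫⁻ t in Set.Iic x, ENNReal.ofReal (q t) ∧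
    0 < ∫⁻ t in Set.Ici x, ENNReal.ofReal (q t)

/-- A principal fundamental system of solutions `u, v` (with a.e. derivatives
`u', v'`) of the equation `(r z')' = q z`:  `u, v, r u', r v'` are locally
absolutely continuous (expressed through the integral identities below),
`(r u')' = q u` and `(r v')' = q v` a.e., `u > 0`, `v > 0`, `v' ≥ 0`, `u' ≤ 0`,
`r (v' u - u' v) ≡ 1`, `v/u → 0` at `-∞`, `u/v → 0` at `+∞`,
`∫_{-∞}^0 dt/(r u²) < ∞` and `∫_0^∞ dt/(r v²) < ∞`. -/
structure PFSS (r q u v u' v' : ℝ → ℝ) : Prop where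
  u_pos : ∀ x, 0 < u x
  v_pos : ∀ x, 0 < v x
  u'_nonpos : ∀ x, u' x ≤ 0
  v'_nonneg : ∀ x, 0 ≤ v' x
  u'_intble : ∀ a b : ℝ, IntervalIntegrable u' volume a b
  v'_intble : ∀ a b : ℝ, IntervalIntegrable v' volume a b
  u_deriv : ∀ a b : ℝ, u b - u a = ∫ t in a..b, u' t
  v_deriv : ∀ a b : ℝ, v b - v a = ∫ t in a..b, v' t
  ru'_deriv : ∀ a b : ℝ, r b * u' b - r a * u' a = ∫ t in a..b, q t * u t
  rv'_deriv : ∀ a b : ℝ, r b * v' b - r a * v' a = ∫ t in a..b, q t * v t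
  wronskian : ∀ x, r x * (v' x * u x - u' x * v x) = 1
  ratio_bot : Tendsto (fun x => v x / u x) atBot (𝓝 0)
  ratio_top : Tendsto (fun x => u x / v x) atTop (𝓝 0)
  int_u : ∫⁻ t in Set.Iic (0:ℝ), ENNReal.ofReal (1 / (r t * u t ^ 2)) < ⊤
  int_v : ∫⁻ t in Set.Ici (0:ℝ), ENNReal.ofReal (1 / (r t * v t ^ 2)) < ⊤

/-- The Green kernel `G(x,t) = u(x) v(t)` for `x ≥ t`, `u(t) v(x)` for `x ≤ t`. -/
def greenKernel (u v : ℝ → ℝ) (x t : ℝ) : ℝ :=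
  if t ≤ x then u x * v t else u t * v x

/-- The space `L_p(ℝ)` (with respect to Lebesgue measure). -/
abbrev LpR (p : ℝ≥0∞) : Type := Lp ℝ p (volume : Measure ℝ)

/-- `G` is (a bounded realization on `L_p` of) the Green operator
`(G f)(x) = ∫_ℝ G(x,t) f(t) dt`. -/
def IsGreenOp (u v : ℝ → ℝ) (p : ℝ≥0∞) [Fact (1 ≤ p)]
    (G : LpR p →L[ℝ] LpR p) : Prop :=
  ∀ f : LpR p,
    (G f : ℝ → ℝ) =ᵐ[volume] fun x => ∫ t, greenKernel u v x t * (f : ℝ → ℝ) t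

/-- `d₁` solves `(∫_{x-d}^x dt/r)(∫_{x-d}^x q dt) = 1`, `d₁ > 0`. -/
def IsD1 (r q d₁ : ℝ → ℝ) : Prop :=
  ∀ x : ℝ, 0 < d₁ x ∧
    (∫ t in x - d₁ x..x, 1 / r t) * (∫ t in x - d₁ x..x, q t) = 1

/-- `d₂` solves `(∫_x^{x+d} dt/r)(∫_x^{x+d} q dt) = 1`, `d₂ > 0`. -/
def IsD2 (r q d₂ : ℝ → ℝ) : Prop :=
  ∀ x : ℝ, 0 < d₂ x ∧
    (∫ t in x..x + d₂ x, 1 / r t) * (∫ t in x..x + d₂ x, q t) = 1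

/-- `φ(x) = ∫_{x-d₁(x)}^x dt/r(t)`. -/
def phiF (r d₁ : ℝ → ℝ) (x : ℝ) : ℝ := ∫ t in x - d₁ x..x, 1 / r t

/-- `ψ(x) = ∫_x^{x+d₂(x)} dt/r(t)`. -/
def psiF (r d₂ : ℝ → ℝ) (x : ℝ) : ℝ := ∫ t in x..x + d₂ x, 1 / r t

/-- `h(x) = φ(x)ψ(x)/(φ(x)+ψ(x))`. -/
def hF (r d₁ d₂ : ℝ → ℝ) (x : ℝ) : ℝ :=
  phiF r d₁ x * psiF r d₂ x / (phiF r d₁ x + psiF r d₂ x)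

/-- `d` solves `∫_{x-d(x)}^{x+d(x)} dt/(r(t)h(t)) = 1`, `d > 0`. -/
def IsD (r h d : ℝ → ℝ) : Prop :=
  ∀ x : ℝ, 0 < d x ∧ (∫ t in x - d x..x + d x, 1 / (r t * h t)) = 1

/-- `s` solves `∫_{x-s(x)}^{x+s(x)} dt/(r(t)ρ(t)) = 1`, `s > 0`. -/
def IsS (r ρ s : ℝ → ℝ) : Prop :=
  ∀ x : ℝ, 0 < s x ∧ (∫ t in x - s x..x + s x, 1 / (r t * ρ t)) = 1


/-- The fundamental theorem of calculus for the logarithm of a positive absolutely continuous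
function. -/
lemma log_sub_log_eq_integral {f f' : ℝ → ℝ} (hpos : ∀ x, 0 < f x)
    (hint : ∀ a b : ℝ, IntervalIntegrable f' volume a b)
    (hf : ∀ a b : ℝ, f b - f a = ∫ t in a..b, f' t) (hcont : Continuous f) (a b : ℝ) :
    Real.log (f b) - Real.log (f a) = ∫ t in a..b, f' t / f t := by
  have hfac : AbsolutelyContinuousOnInterval f a b := by
    have h1 := (hint a b).absolutelyContinuousOnInterval_intervalIntegral
      (c := a) (Set.left_mem_uIcc)
    have h2 : f = fun x => f a + ∫ t in a..x, f' t := by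
      funext x; rw [← hf a x]; ring
    rw [h2]
    refine AbsolutelyContinuousOnInterval.add (f := fun _ => f a) ?_ h1
    exact (LipschitzWith.const (f a)).lipschitzOnWith.absolutelyContinuousOnInterval
  have hlog : AbsolutelyContinuousOnInterval (fun x => Real.log (f x)) a b := by
    obtain ⟨x₀, -, hx₀⟩ := isCompact_uIcc.exists_isMinOn (Set.nonempty_uIcc (a := a) (b := b))
      hcont.continuousOn
    have hm := hpos x₀
    have key : ∀ x ∈ Set.uIcc a b, ∀ y ∈ Set.uIcc a b,
        dist (Real.log (f x)) (Real.log (f y)) ≤ (f x₀)⁻¹ * dist (f x) (f y) := by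
      have aux : ∀ x ∈ Set.uIcc a b, ∀ y ∈ Set.uIcc a b,
          Real.log (f x) - Real.log (f y) ≤ (f x₀)⁻¹ * |f x - f y| := by
        intro x _ y hy
        have hy' : f x₀ ≤ f y := hx₀ hy
        have h1 := Real.log_le_sub_one_of_pos (div_pos (hpos x) (hpos y))
        rw [Real.log_div (hpos x).ne' (hpos y).ne'] at h1
        have h2 : f x / f y - 1 = (f y)⁻¹ * (f x - f y) := by
          have := (hpos y).ne'
          field_simp
        rw [h2] at h1
        refine h1.trans ?_
        calc (f y)⁻¹ * (f x - f y) ≤ (f y)⁻¹ * |f x - f y| :=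
              mul_le_mul_of_nonneg_left (le_abs_self _) (inv_nonneg.2 (hpos y).le)
          _ ≤ _ := mul_le_mul_of_nonneg_right (inv_anti₀ hm hy') (abs_nonneg _)
      intro x hx y hy
      rw [Real.dist_eq, Real.dist_eq]
      refine abs_sub_le_iff.2 ⟨aux x hx y hy, ?_⟩
      rw [abs_sub_comm]
      exact aux y hy x hx
    rw [absolutelyContinuousOnInterval_iff] at hfac ⊢
    intro ε hε
    obtain ⟨δ, hδ, h⟩ := hfac (f x₀ * ε) (mul_pos hm hε)
    refine ⟨δ, hδ, fun E hE hE' => ?_⟩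
    have h1 := h E hE hE'
    calc _ ≤ ∑ i ∈ Finset.range E.1, (f x₀)⁻¹ * dist (f (E.2 i).1) (f (E.2 i).2) :=
          Finset.sum_le_sum fun i hi => key _ (hE.1 i hi).1 _ (hE.1 i hi).2
      _ = (f x₀)⁻¹ * ∑ i ∈ Finset.range E.1, dist (f (E.2 i).1) (f (E.2 i).2) := by
          rw [Finset.mul_sum]
      _ < (f x₀)⁻¹ * (f x₀ * ε) := by gcongr
      _ = ε := by field_simp
  rw [← hlog.integral_deriv_eq_sub]
  refine intervalIntegral.integral_congr_ae ?_
  filter_upwards [(hint a b).ae_hasDerivAt_integral] with x hx hxab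
  have hd := hx (Set.uIoc_subset_uIcc hxab) a Set.left_mem_uIcc
  have hd' : HasDerivAt f (f' x) x := by
    have h2 : f = fun x => f a + ∫ t in a..x, f' t := by
      funext x; rw [← hf a x]; ring
    rw [h2]
    exact hd.const_add _
  exact (hd'.log (hpos x).ne').deriv

/-- Logarithmic coordinates of a principal fundamental system: `u = exp A` and
`v = exp (A + θ)`. -/
structure LogPair (A θ : ℝ → ℝ) : Prop where
  cont_A : Continuous A
  cont_θ : Continuous θ
  strictMono : StrictMono θ
  tendsto_top : Tendsto θ atTop atTop
  tendsto_bot : Tendsto θ atBot atBot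
  anti : Antitone A
  mono : Monotone fun x => A x + θ x

/-- The Green kernel in logarithmic coordinates. -/
def logKernel (A θ : ℝ → ℝ) (x t : ℝ) : ℝ := Real.exp (A x + A t + min (θ x) (θ t))

/-- The diagonal of the Green kernel in logarithmic coordinates. -/
def logDiag (A θ : ℝ → ℝ) (x : ℝ) : ℝ := Real.exp (2 * A x + θ x)

lemma PFSS.exists_logPair {r q u v u' v' : ℝ → ℝ} (hr : ∀ x, 0 < r x)
    (h : PFSS r q u v u' v') :
    ∃ A θ : ℝ → ℝ, LogPair A θ ∧ (∀ x t, greenKernel u v x t = logKernel A θ x t) ∧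
      (∀ x, u x * v x = logDiag A θ x) ∧
      ∀ a b, ∫ t in a..b, 1 / (r t * (u t * v t)) = θ b - θ a := by
  have hcu : Continuous u := by
    have h2 : u = fun x => u 0 + ∫ t in (0:ℝ)..x, u' t := by
      funext x; rw [← h.u_deriv 0 x]; ring
    rw [h2]
    exact continuous_const.add (intervalIntegral.continuous_primitive h.u'_intble 0)
  have hcv : Continuous v := by
    have h2 : v = fun x => v 0 + ∫ t in (0:ℝ)..x, v' t := by
      funext x; rw [← h.v_deriv 0 x]; ring
    rw [h2]
    exact continuous_const.add (intervalIntegral.continuous_primitive h.v'_intble 0)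
  set A : ℝ → ℝ := fun x => Real.log (u x) with hA
  set θ : ℝ → ℝ := fun x => Real.log (v x) - Real.log (u x) with hθ
  have hu : ∀ x, u x = Real.exp (A x) := fun x => (Real.exp_log (h.u_pos x)).symm
  have hv : ∀ x, v x = Real.exp (A x + θ x) := fun x => by
    simp only [hA, hθ, add_sub_cancel]; exact (Real.exp_log (h.v_pos x)).symm
  have hcA : Continuous A := hcu.log fun x => (h.u_pos x).ne'
  have hcθ : Continuous θ := (hcv.log fun x => (h.v_pos x).ne').sub hcA
  have hanti : Antitone A := by
    intro a b hab
    refine Real.log_le_log (h.u_pos b) ?_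
    have := h.u_deriv a b
    have h0 : ∫ t in a..b, u' t ≤ 0 := by
      have := intervalIntegral.integral_mono_on hab (h.u'_intble a b)
        (intervalIntegrable_const (c := (0:ℝ))) (fun x _ => h.u'_nonpos x)
      simpa using this
    linarith
  have hmono : Monotone fun x => A x + θ x := by
    intro a b hab
    simp only [hA, hθ, add_sub_cancel]
    refine Real.log_le_log (h.v_pos a) ?_
    have := h.v_deriv a b
    have h0 : 0 ≤ ∫ t in a..b, v' t :=
      intervalIntegral.integral_nonneg hab (fun x _ => h.v'_nonneg x)
    linarith
  have hiu : ∀ a b, IntervalIntegrable (fun t => u' t / u t) volume a b := fun a b => by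
    simp only [div_eq_mul_inv]
    exact (h.u'_intble a b).mul_continuousOn
      (hcu.inv₀ fun x => (h.u_pos x).ne').continuousOn
  have hiv : ∀ a b, IntervalIntegrable (fun t => v' t / v t) volume a b := fun a b => by
    simp only [div_eq_mul_inv]
    exact (h.v'_intble a b).mul_continuousOn
      (hcv.inv₀ fun x => (h.v_pos x).ne').continuousOn
  have hpt : ∀ t, 1 / (r t * (u t * v t)) = v' t / v t - u' t / u t := fun t => by
    have h1 := h.u_pos t
    have h2 := h.v_pos t
    have h3 := hr t
    rw [← h.wronskian t]
    field_simp
  have hI : ∀ a b, ∫ t in a..b, 1 / (r t * (u t * v t)) = θ b - θ a := by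
    intro a b
    simp only [hpt]
    rw [intervalIntegral.integral_sub (hiv a b) (hiu a b),
      ← log_sub_log_eq_integral h.u_pos h.u'_intble h.u_deriv hcu,
      ← log_sub_log_eq_integral h.v_pos h.v'_intble h.v_deriv hcv]
    simp only [hθ]; ring
  have hsm : StrictMono θ := by
    intro a b hab
    have h1 : 0 < ∫ t in a..b, 1 / (r t * (u t * v t)) := by
      refine intervalIntegral.intervalIntegral_pos_of_pos ?_ (fun t => ?_) hab
      · simp only [hpt]; exact (hiv a b).sub (hiu a b)
      · have h1 := h.u_pos t
        have h2 := h.v_pos t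
        have h3 := hr t
        positivity
    rw [hI] at h1
    linarith
  refine ⟨A, θ, ⟨hcA, hcθ, hsm, ?_, ?_, hanti, hmono⟩, ?_, ?_, hI⟩
  · have h1 : Tendsto (fun x => Real.log (u x / v x)) atTop atBot :=
      Real.tendsto_log_nhdsGT_zero.comp (tendsto_nhdsWithin_iff.2
        ⟨h.ratio_top, .of_forall fun x => div_pos (h.u_pos x) (h.v_pos x)⟩)
    refine (tendsto_neg_atBot_atTop.comp h1).congr fun x => ?_
    simp only [Function.comp, hθ, Real.log_div (h.u_pos x).ne' (h.v_pos x).ne']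
    ring
  · have h1 : Tendsto (fun x => Real.log (v x / u x)) atBot atBot :=
      Real.tendsto_log_nhdsGT_zero.comp (tendsto_nhdsWithin_iff.2
        ⟨h.ratio_bot, .of_forall fun x => div_pos (h.v_pos x) (h.u_pos x)⟩)
    refine h1.congr fun x => ?_
    simp only [hθ, Real.log_div (h.v_pos x).ne' (h.u_pos x).ne']
  · intro x t
    unfold greenKernel logKernel
    split_ifs with hxt
    · rw [min_eq_right (hsm.monotone hxt), hu x, hv t, ← Real.exp_add]; congr 1; ring
    · rw [min_eq_left (hsm.monotone (not_le.1 hxt).le), hu t, hv x, ← Real.exp_add]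
      congr 1; ring
  · intro x
    rw [hu x, hv x, logDiag, ← Real.exp_add]; congr 1; ring

namespace LogPair

variable {A θ : ℝ → ℝ}

lemma kernel_le_exp_mul (h : LogPair A θ) (x y t : ℝ) :
    logKernel A θ x t ≤ Real.exp |θ x - θ y| * logKernel A θ y t := by
  unfold logKernel
  rw [← Real.exp_add, Real.exp_le_exp]
  rcases le_total x y with hxy | hxy
  · have h1 := h.anti hxy
    have h2 : A x + θ x ≤ A y + θ y := h.mono hxy
    have h3 := h.strictMono.monotone hxy
    rw [abs_of_nonpos (by linarith)]
    have : min (θ x) (θ t) ≤ min (θ y) (θ t) := min_le_min_right _ h3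
    linarith
  · have h1 := h.anti hxy
    have h3 := h.strictMono.monotone hxy
    rw [abs_of_nonneg (by linarith)]
    have : min (θ x) (θ t) ≤ min (θ y) (θ t) + (θ x - θ y) := by
      rcases le_total (θ y) (θ t) with h4 | h4
      · rw [min_eq_left h4]; linarith [min_le_left (θ x) (θ t)]
      · rw [min_eq_right h4]; linarith [min_le_right (θ x) (θ t)]
    linarith

lemma logKernel_comm (x t : ℝ) : logKernel A θ x t = logKernel A θ t x := by
  unfold logKernel
  rw [min_comm, add_comm (A x)]

lemma logKernel_self (x : ℝ) : logKernel A θ x x = logDiag A θ x := by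
  unfold logKernel logDiag
  rw [min_self]; congr 1; ring

lemma diag_le_exp_mul_kernel (h : LogPair A θ) (x y t : ℝ) :
    logDiag A θ x ≤ Real.exp (|θ x - θ y| + |θ x - θ t|) * logKernel A θ y t := by
  rw [← logKernel_self, Real.exp_add, mul_assoc]
  refine (h.kernel_le_exp_mul x y x).trans (mul_le_mul_of_nonneg_left ?_ (Real.exp_pos _).le)
  rw [logKernel_comm y x, logKernel_comm y t]
  exact h.kernel_le_exp_mul x t y

lemma kernel_le_rpow_mul (h : LogPair A θ) {α δ : ℝ} (h1 : δ ≤ α) (h2 : δ ≤ 1 - α) (x t : ℝ) :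
    logKernel A θ x t ≤
      logDiag A θ x ^ α * (logDiag A θ t ^ (1 - α) * Real.exp (-(δ * |θ x - θ t|))) := by
  unfold logKernel logDiag
  rw [← Real.exp_mul, ← Real.exp_mul, ← Real.exp_add, ← Real.exp_add, Real.exp_le_exp]
  rcases le_total t x with hxt | hxt
  all_goals
    have e1 := h.anti hxt
    have e2 := h.mono hxt
    have e3 := h.strictMono.monotone hxt
    simp only at e2
  · rw [min_eq_right e3, abs_of_nonneg (by linarith)]
    rcases le_total 0 (1 - 2 * α) with h3 | h3
    · nlinarith [mul_nonneg h3 (sub_nonneg.2 e1),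
        mul_nonneg (sub_nonneg.2 h1) (sub_nonneg.2 e3)]
    · nlinarith [mul_nonneg_of_nonpos_of_nonpos h3 (sub_nonpos.2 e2),
        mul_nonneg (sub_nonneg.2 h2) (sub_nonneg.2 e3)]
  · rw [min_eq_left e3, abs_of_nonpos (by linarith)]
    rcases le_total 0 (1 - 2 * α) with h3 | h3
    · nlinarith [mul_nonneg h3 (sub_nonneg.2 e2),
        mul_nonneg (sub_nonneg.2 h1) (sub_nonneg.2 e3)]
    · nlinarith [mul_nonneg_of_nonpos_of_nonpos h3 (sub_nonpos.2 e1),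
        mul_nonneg (sub_nonneg.2 h2) (sub_nonneg.2 e3)]

lemma surjective (h : LogPair A θ) : Function.Surjective θ :=
  h.cont_θ.surjective h.tendsto_top h.tendsto_bot

end LogPair

lemma lintegral_exp_neg_mul_abs_lt_top {δ : ℝ} (hδ : 0 < δ) :
    ∫⁻ c : ℝ, ENNReal.ofReal (Real.exp (δ - δ * |c|)) < ⊤ := by
  have h1 : Integrable (fun c : ℝ => Real.exp (δ - δ * |c|)) := by
    rw [← integrableOn_univ, ← Set.Iic_union_Ioi (a := (0:ℝ))]
    refine IntegrableOn.union ?_ ?_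
    · have h2 : IntegrableOn (fun c => Real.exp δ * Real.exp (δ * c)) (Set.Iic 0) :=
        Integrable.const_mul (integrableOn_exp_mul_Iic hδ 0) _
      refine h2.congr_fun (fun c hc => ?_) measurableSet_Iic
      simp only [← Real.exp_add, abs_of_nonpos (Set.mem_Iic.1 hc)]
      congr 1; ring
    · have h2 : IntegrableOn (fun c => Real.exp δ * Real.exp (-δ * c)) (Set.Ioi 0) :=
        Integrable.const_mul (exp_neg_integrableOn_Ioi 0 hδ) _
      refine h2.congr_fun (fun c hc => ?_) measurableSet_Ioi
      simp only [← Real.exp_add, abs_of_pos (Set.mem_Ioi.1 hc)]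
      congr 1; ring
  exact h1.lintegral_lt_top

namespace LogPair

variable {A θ : ℝ → ℝ}

lemma measurable_diag (h : LogPair A θ) :
    Measurable fun x => ENNReal.ofReal (logDiag A θ x) := by
  have := h.cont_A
  have := h.cont_θ
  unfold logDiag
  fun_prop

lemma continuous_kernel (h : LogPair A θ) :
    Continuous fun z : ℝ × ℝ => logKernel A θ z.1 z.2 := by
  have := h.cont_A
  have := h.cont_θ
  unfold logKernel
  fun_prop

/-- The mass of `ρ` on a unit window of `θ` is controlled by `ρ s` at the midpoint of the
window. -/
lemma exists_lintegral_window_le (h : LogPair A θ) {s : ℝ → ℝ}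
    (hs : ∀ x, 0 < s x ∧ θ (x + s x) - θ (x - s x) = 1) (c : ℝ) :
    ∃ m, c ≤ θ m ∧ θ m ≤ c + 1 ∧
      ∫⁻ x in {x | c ≤ θ x ∧ θ x ≤ c + 1}, ENNReal.ofReal (logDiag A θ x) ≤
        ENNReal.ofReal (2 * Real.exp 2 * (logDiag A θ m * s m)) := by
  obtain ⟨a, ha⟩ := h.surjective c
  obtain ⟨b, hb⟩ := h.surjective (c + 1)
  have hab : a < b := h.strictMono.lt_iff_lt.1 (by linarith)
  have hm1 : c ≤ θ ((a + b) / 2) := by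
    rw [← ha]; exact h.strictMono.monotone (by linarith)
  have hm2 : θ ((a + b) / 2) ≤ c + 1 := by
    rw [← hb]; exact h.strictMono.monotone (by linarith)
  obtain ⟨hs0, hs1⟩ := hs ((a + b) / 2)
  have hsm : s ((a + b) / 2) = (b - a) / 2 := by
    rcases lt_trichotomy (s ((a + b) / 2)) ((b - a) / 2) with h1 | h1 | h1
    · have e1 := h.strictMono (show (a + b) / 2 + s ((a + b) / 2) < b by linarith)
      have e2 := h.strictMono (show a < (a + b) / 2 - s ((a + b) / 2) by linarith)
      linarith
    · exact h1
    · have e1 := h.strictMono (show b < (a + b) / 2 + s ((a + b) / 2) by linarith)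
      have e2 := h.strictMono (show (a + b) / 2 - s ((a + b) / 2) < a by linarith)
      linarith
  refine ⟨(a + b) / 2, hm1, hm2, ?_⟩
  have hset : {x | c ≤ θ x ∧ θ x ≤ c + 1} = Set.Icc a b := by
    ext x
    rw [← ha, show θ a + 1 = θ b by linarith]
    simp only [Set.mem_ofPred_eq, h.strictMono.le_iff_le, Set.mem_Icc]
  calc ∫⁻ x in {x | c ≤ θ x ∧ θ x ≤ c + 1}, ENNReal.ofReal (logDiag A θ x)
      ≤ ∫⁻ x in Set.Icc a b,
          ENNReal.ofReal (Real.exp 2 * logDiag A θ ((a + b) / 2)) := by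
        rw [hset]
        refine setLIntegral_mono measurable_const fun x hx => ENNReal.ofReal_le_ofReal ?_
        have e1 := h.strictMono.monotone hx.1
        have e2 := h.strictMono.monotone hx.2
        have e3 := h.diag_le_exp_mul_kernel x ((a + b) / 2) ((a + b) / 2)
        rw [logKernel_self] at e3
        refine e3.trans (mul_le_mul_of_nonneg_right (Real.exp_le_exp.2 ?_) (Real.exp_pos _).le)
        have : |θ x - θ ((a + b) / 2)| ≤ 1 := by
          rw [abs_le]; constructor <;> linarith
        linarith
    _ = ENNReal.ofReal (2 * Real.exp 2 * (logDiag A θ ((a + b) / 2) * s ((a + b) / 2))) := by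
        have h0 : 0 ≤ Real.exp 2 * logDiag A θ ((a + b) / 2) :=
          mul_nonneg (Real.exp_pos _).le (Real.exp_pos _).le
        rw [setLIntegral_const, Real.volume_Icc, ← ENNReal.ofReal_mul h0, hsm]
        congr 1; ring

/-- Uniform bounds on unit windows of `θ` give uniform bounds against exponentially decaying
weights. -/
lemma lintegral_exp_mul_le (h : LogPair A θ) {δ : ℝ} (hδ : 0 < δ) {T : Set ℝ} {M : ℝ≥0∞}
    (hM : ∀ c : ℝ, ∫⁻ x in {x | c ≤ θ x ∧ θ x ≤ c + 1},
      T.indicator (fun x => ENNReal.ofReal (logDiag A θ x)) x ≤ M)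
    (hT : MeasurableSet T) (τ : ℝ) :
    ∫⁻ x in T, ENNReal.ofReal (Real.exp (-(δ * |θ x - τ|))) * ENNReal.ofReal (logDiag A θ x) ≤
      (∫⁻ c : ℝ, ENNReal.ofReal (Real.exp (δ - δ * |c|))) * M := by
  have hθ := h.cont_θ
  have hR := h.measurable_diag
  set J : Set (ℝ × ℝ) := {z | z.2 ≤ θ z.1 ∧ θ z.1 ≤ z.2 + 1} with hJ
  have hJm : MeasurableSet J :=
    ((isClosed_le continuous_snd (hθ.comp continuous_fst)).inter
      (isClosed_le (hθ.comp continuous_fst)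
        (continuous_snd.add continuous_const))).measurableSet
  set R : ℝ → ℝ≥0∞ := T.indicator fun x => ENNReal.ofReal (logDiag A θ x) with hRdef
  have hRm : Measurable R := hR.indicator hT
  set e : ℝ → ℝ≥0∞ := fun c => ENNReal.ofReal (Real.exp (δ - δ * |c - τ|)) with he
  have hem : Measurable e := by fun_prop
  set F : ℝ → ℝ → ℝ≥0∞ := fun x c => J.indicator (fun z => e z.2 * R z.1) (x, c) with hF
  have hFm : Measurable (Function.uncurry F) := by
    have : Function.uncurry F = J.indicator (fun z => e z.2 * R z.1) := by
      ext ⟨x, c⟩; rfl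
    rw [this]
    exact Measurable.indicator ((hem.comp measurable_snd).mul (hRm.comp measurable_fst)) hJm
  have key : ∀ x, ENNReal.ofReal (Real.exp (-(δ * |θ x - τ|))) * R x ≤ ∫⁻ c, F x c := by
    intro x
    calc ENNReal.ofReal (Real.exp (-(δ * |θ x - τ|))) * R x
        = ∫⁻ c in Set.Icc (θ x - 1) (θ x),
            ENNReal.ofReal (Real.exp (-(δ * |θ x - τ|))) * R x := by
          simp
      _ ≤ ∫⁻ c in Set.Icc (θ x - 1) (θ x), F x c := by
          refine setLIntegral_mono (hFm.comp measurable_prodMk_left) fun c hc => ?_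
          have hmem : (x, c) ∈ J := ⟨hc.2, by linarith [hc.1]⟩
          simp only [hF, Set.indicator_of_mem hmem]
          refine mul_le_mul_left (ENNReal.ofReal_le_ofReal (Real.exp_le_exp.2 ?_)) _
          have : |c - τ| ≤ |θ x - τ| + 1 := by
            have e1 : |c - τ| ≤ |c - θ x| + |θ x - τ| := abs_sub_le _ _ _
            have e2 : |c - θ x| ≤ 1 := by
              rw [abs_le]; constructor <;> linarith [hc.1, hc.2]
            linarith
          nlinarith
      _ ≤ ∫⁻ c, F x c := setLIntegral_le_lintegral _ _
  calc ∫⁻ x in T, ENNReal.ofReal (Real.exp (-(δ * |θ x - τ|))) * ENNReal.ofReal (logDiag A θ x)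
      = ∫⁻ x, ENNReal.ofReal (Real.exp (-(δ * |θ x - τ|))) * R x := by
        rw [← lintegral_indicator hT]
        refine lintegral_congr fun x => ?_
        by_cases hx : x ∈ T <;> simp [hRdef, hx]
    _ ≤ ∫⁻ x, ∫⁻ c, F x c := lintegral_mono key
    _ = ∫⁻ c, ∫⁻ x, F x c := lintegral_lintegral_swap hFm.aemeasurable
    _ ≤ ∫⁻ c, e c * M := by
        refine lintegral_mono fun c => ?_
        have hJc : MeasurableSet {x | c ≤ θ x ∧ θ x ≤ c + 1} :=
          (measurable_prodMk_right (y := c)) hJm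
        calc ∫⁻ x, F x c
            = ∫⁻ x, {x | c ≤ θ x ∧ θ x ≤ c + 1}.indicator (fun x => e c * R x) x := rfl
          _ = e c * ∫⁻ x in {x | c ≤ θ x ∧ θ x ≤ c + 1}, R x := by
              rw [lintegral_indicator hJc, lintegral_const_mul _ hRm]
          _ ≤ e c * M := by gcongr; exact hM c
    _ = (∫⁻ c, e c) * M := lintegral_mul_const _ hem
    _ = _ := by
        congr 1
        exact lintegral_sub_right_eq_self (fun c => ENNReal.ofReal (Real.exp (δ - δ * |c|))) τ

/-- Schur test for the Green kernel. -/
lemma setLIntegral_kernel_rpow_le (h : LogPair A θ) {p δ : ℝ} (hp : 1 < p) (h1 : δ ≤ 1 / p)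
    (h2 : δ ≤ 1 - 1 / p) {T : Set ℝ} {C ε : ℝ≥0∞}
    (hC : ∀ τ, ∫⁻ x, ENNReal.ofReal (Real.exp (-(δ * |θ x - τ|))) *
      ENNReal.ofReal (logDiag A θ x) ≤ C)
    (hε : ∀ τ, ∫⁻ x in T, ENNReal.ofReal (Real.exp (-(δ * |θ x - τ|))) *
      ENNReal.ofReal (logDiag A θ x) ≤ ε)
    {f : ℝ → ℝ≥0∞} (hf : Measurable f) :
    ∫⁻ x in T, (∫⁻ t, ENNReal.ofReal (logKernel A θ x t) * f t) ^ p ≤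
      C ^ (p - 1) * ε * ∫⁻ t, f t ^ p := by
  have hp0 : 0 < p := by linarith
  have hθ := h.cont_θ
  have hR := h.measurable_diag
  have hq : 0 ≤ 1 - 1 / p := by
    rw [sub_nonneg, div_le_one hp0]; exact hp.le
  set R : ℝ → ℝ≥0∞ := fun x => ENNReal.ofReal (logDiag A θ x) with hRdef
  set E : ℝ → ℝ → ℝ≥0∞ := fun x t => ENNReal.ofReal (Real.exp (-(δ * |θ x - θ t|))) with hE
  have hEsymm : ∀ x t, E x t = E t x := fun x t => by simp only [hE, abs_sub_comm]
  have hEm : Measurable (Function.uncurry E) := by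
    have : Function.uncurry E =
      fun z : ℝ × ℝ => ENNReal.ofReal (Real.exp (-(δ * |θ z.1 - θ z.2|))) := by
        ext ⟨x, t⟩; rfl
    rw [this]
    fun_prop
  have hEm1 : ∀ x, Measurable (E x) := fun x => hEm.comp measurable_prodMk_left
  have hK : ∀ x t, ENNReal.ofReal (logKernel A θ x t) ≤
      R x ^ (1 / p) * (R t ^ (1 - 1 / p) * E x t) := by
    intro x t
    have e0 : ∀ y, 0 < logDiag A θ y := fun y => Real.exp_pos _
    refine (ENNReal.ofReal_le_ofReal (h.kernel_le_rpow_mul h1 h2 x t)).trans_eq ?_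
    rw [ENNReal.ofReal_mul (Real.rpow_nonneg (e0 x).le _),
      ENNReal.ofReal_mul (Real.rpow_nonneg (e0 t).le _), hRdef]
    simp only
    rw [ENNReal.ofReal_rpow_of_pos (e0 x), ENNReal.ofReal_rpow_of_pos (e0 t)]
  have hpt : ∀ x, (∫⁻ t, ENNReal.ofReal (logKernel A θ x t) * f t) ^ p ≤
      C ^ (p - 1) * ∫⁻ t, E x t * R x * f t ^ p := by
    intro x
    have e1 : ∫⁻ t, ENNReal.ofReal (logKernel A θ x t) * f t ≤
        R x ^ (1 / p) * (C ^ (1 - 1 / p) * (∫⁻ t, E x t * f t ^ p) ^ (1 / p)) := by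
      calc ∫⁻ t, ENNReal.ofReal (logKernel A θ x t) * f t
          ≤ ∫⁻ t, R x ^ (1 / p) *
              ((E x t * R t) ^ (1 - 1 / p) * (E x t * f t ^ p) ^ (1 / p)) := by
            refine lintegral_mono fun t => ?_
            refine (mul_le_mul_left (hK x t) (f t)).trans_eq ?_
            rw [ENNReal.mul_rpow_of_nonneg _ _ hq,
              ENNReal.mul_rpow_of_nonneg _ _ (by positivity : 0 ≤ 1 / p),
              ← ENNReal.rpow_mul (f t), mul_one_div_cancel hp0.ne', ENNReal.rpow_one]
            have e2 : E x t = E x t ^ (1 - 1 / p) * E x t ^ (1 / p) := by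
              rw [← ENNReal.rpow_add_of_nonneg _ _ hq (by positivity)]; simp
            conv_lhs => rw [e2]
            ring
        _ = R x ^ (1 / p) *
              ∫⁻ t, (E x t * R t) ^ (1 - 1 / p) * (E x t * f t ^ p) ^ (1 / p) := by
            refine lintegral_const_mul _ ?_
            exact (((hEm1 x).mul hR).pow_const _).mul
              (((hEm1 x).mul (hf.pow_const _)).pow_const _)
        _ ≤ R x ^ (1 / p) * ((∫⁻ t, E x t * R t) ^ (1 - 1 / p) *
              (∫⁻ t, E x t * f t ^ p) ^ (1 / p)) := by
            refine mul_le_mul_right ?_ _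
            exact ENNReal.lintegral_mul_norm_pow_le ((hEm1 x).mul hR).aemeasurable
              ((hEm1 x).mul (hf.pow_const _)).aemeasurable hq (by positivity) (by ring)
        _ ≤ _ := by
            refine mul_le_mul_right (mul_le_mul_left (ENNReal.rpow_le_rpow ?_ hq) _) _
            refine le_trans (le_of_eq ?_) (hC (θ x))
            refine lintegral_congr fun t => ?_
            rw [hEsymm]
    calc (∫⁻ t, ENNReal.ofReal (logKernel A θ x t) * f t) ^ p
        ≤ (R x ^ (1 / p) * (C ^ (1 - 1 / p) * (∫⁻ t, E x t * f t ^ p) ^ (1 / p))) ^ p :=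
          ENNReal.rpow_le_rpow e1 hp0.le
      _ = C ^ (p - 1) * (R x * ∫⁻ t, E x t * f t ^ p) := by
          rw [ENNReal.mul_rpow_of_nonneg _ _ hp0.le, ENNReal.mul_rpow_of_nonneg _ _ hp0.le,
            ← ENNReal.rpow_mul, ← ENNReal.rpow_mul, ← ENNReal.rpow_mul,
            one_div_mul_cancel hp0.ne', ENNReal.rpow_one, ENNReal.rpow_one,
            show (1 - 1 / p) * p = p - 1 by field_simp]
          ring
      _ = _ := by
          have e3 : ∫⁻ t, R x * (E x t * f t ^ p) = R x * ∫⁻ t, E x t * f t ^ p :=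
            lintegral_const_mul _ ((hEm1 x).mul (hf.pow_const _))
          rw [← e3]
          congr 1
          refine lintegral_congr fun t => ?_
          ring
  have hprod : Measurable (Function.uncurry fun x t => E x t * R x * f t ^ p) :=
    (hEm.mul (hR.comp measurable_fst)).mul ((hf.pow_const p).comp measurable_snd)
  calc ∫⁻ x in T, (∫⁻ t, ENNReal.ofReal (logKernel A θ x t) * f t) ^ p
      ≤ ∫⁻ x in T, C ^ (p - 1) * ∫⁻ t, E x t * R x * f t ^ p := lintegral_mono fun x => hpt x
    _ = C ^ (p - 1) * ∫⁻ x in T, ∫⁻ t, E x t * R x * f t ^ p :=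
        lintegral_const_mul _ hprod.lintegral_prod_right'
    _ = C ^ (p - 1) * ∫⁻ t, ∫⁻ x in T, E x t * R x * f t ^ p := by
        rw [lintegral_lintegral_swap hprod.aemeasurable]
    _ ≤ C ^ (p - 1) * ∫⁻ t, ε * f t ^ p := by
        refine mul_le_mul_right (lintegral_mono fun t => ?_) _
        rw [lintegral_mul_const]
        · exact mul_le_mul_left (hε (θ t)) _
        · exact (hEm.comp measurable_prodMk_right).mul hR
    _ = _ := by
        rw [lintegral_const_mul _ (hf.pow_const p), mul_assoc]

end LogPair

/-- An operator whose values on the unit ball are uniformly close to finite-dimensional subspaces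
is compact. -/
lemma isCompactOperator_of_forall_exists_finiteDimensional {E F : Type*}
    [NormedAddCommGroup E] [NormedSpace ℝ E] [NormedAddCommGroup F] [NormedSpace ℝ F]
    [CompleteSpace F] (G : E →L[ℝ] F)
    (h : ∀ ε > 0, ∃ W : Submodule ℝ F, FiniteDimensional ℝ W ∧
      ∀ f, ‖f‖ ≤ 1 → ∃ w ∈ W, ‖G f - w‖ ≤ ε) : IsCompactOperator G := by
  refine (isCompactOperator_iff_isCompact_closure_image_closedBall (G : E →ₗ[ℝ] F)
    zero_lt_one).2 ?_
  refine TotallyBounded.isCompact_of_isClosed (TotallyBounded.closure ?_) isClosed_closure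
  rw [Metric.totallyBounded_iff]
  intro ε hε
  obtain ⟨W, hW, hWG⟩ := h (ε / 2) (by positivity)
  have hproper : ProperSpace W := FiniteDimensional.proper ℝ W
  have hcpt : IsCompact ((fun w : W => (w : F)) '' Metric.closedBall 0 (‖G‖ + ε / 2)) :=
    (isCompact_closedBall _ _).image continuous_subtype_val
  obtain ⟨t, ht, htc⟩ := Metric.totallyBounded_iff.1 hcpt.totallyBounded (ε / 2) (by positivity)
  refine ⟨t, ht, ?_⟩
  rintro _ ⟨f, hf, rfl⟩
  have hf1 : ‖f‖ ≤ 1 := by simpa using hf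
  obtain ⟨w, hw, hGw⟩ := hWG f hf1
  have hwn : ‖w‖ ≤ ‖G‖ + ε / 2 := by
    have e1 : ‖G f‖ ≤ ‖G‖ := G.unit_le_opNorm f hf1
    have e2 : ‖w‖ ≤ ‖G f‖ + ‖G f - w‖ := norm_le_norm_add_norm_sub _ _
    linarith
  have hwt := htc ⟨⟨w, hw⟩, by simpa using hwn, rfl⟩
  simp only [Set.mem_iUnion, Metric.mem_ball] at hwt ⊢
  obtain ⟨y, hy, hwy⟩ := hwt
  refine ⟨y, hy, ?_⟩
  calc dist (G f) y ≤ dist (G f) w + dist w y := dist_triangle _ _ _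
    _ < ε / 2 + ε / 2 := by
        rw [dist_eq_norm (G f) w]
        exact add_lt_add_of_le_of_lt hGw hwy
    _ = ε := by ring

/-- The image of the unit ball under a compact operator into `L_p` has uniformly small tails. -/
lemma IsCompactOperator.exists_isCompact_eLpNorm_indicator_le {E : Type*}
    [NormedAddCommGroup E] [NormedSpace ℝ E] {p : ℝ≥0∞} [Fact (1 ≤ p)] (hp : p ≠ ⊤)
    {G : E →L[ℝ] LpR p} (hG : IsCompactOperator G) {ε : ℝ} (hε : 0 < ε) :
    ∃ K : Set ℝ, IsCompact K ∧ ∀ f, ‖f‖ ≤ 1 →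
      eLpNorm (Kᶜ.indicator (G f : ℝ → ℝ)) p volume ≤ ENNReal.ofReal ε := by
  have h1 := IsCompactOperator.isCompact_closure_image_closedBall
    (f := (G : E →ₗ[ℝ] LpR p)) hG 1
  obtain ⟨t, ht, htc⟩ := Metric.totallyBounded_iff.1
    (h1.totallyBounded.subset subset_closure) (ε / 2) (by positivity)
  have h2 : ∀ y : LpR p, ∃ K : Set ℝ, IsCompact K ∧
      eLpNorm (Kᶜ.indicator (y : ℝ → ℝ)) p volume ≤ ENNReal.ofReal (ε / 2) := by
    intro y
    obtain ⟨g, hg, hyg, -, -⟩ := (Lp.memLp y).exists_hasCompactSupport_eLpNorm_sub_le hp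
      (ε := ENNReal.ofReal (ε / 2)) (by simpa using hε)
    refine ⟨tsupport g, hg, le_trans ?_ hyg⟩
    rw [show (tsupport g)ᶜ.indicator (y : ℝ → ℝ) =
      (tsupport g)ᶜ.indicator ((y : ℝ → ℝ) - g) from ?_]
    · exact eLpNorm_indicator_le _
    · refine Set.indicator_congr fun x hx => ?_
      simp [image_eq_zero_of_notMem_tsupport hx]
  choose K hK hKy using h2
  refine ⟨⋃ y ∈ t, K y, ht.isCompact_biUnion fun y _ => hK y, fun f hf => ?_⟩
  have h3 := htc ⟨f, by simpa using hf, rfl⟩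
  simp only [Set.mem_iUnion, Metric.mem_ball] at h3
  obtain ⟨y, hy, hfy⟩ := h3
  set S : Set ℝ := (⋃ y ∈ t, K y)ᶜ with hS
  have hSm : MeasurableSet S :=
    (ht.isCompact_biUnion fun y _ => hK y).measurableSet.compl
  have hSK : S ⊆ (K y)ᶜ := Set.compl_subset_compl.2 (Set.subset_biUnion_of_mem hy)
  have e1 : S.indicator (G f : ℝ → ℝ) =
      S.indicator ((G f : ℝ → ℝ) - (y : ℝ → ℝ)) + S.indicator (y : ℝ → ℝ) := by
    rw [← Set.indicator_add']
    simp
  have e2 : eLpNorm ((G f : ℝ → ℝ) - (y : ℝ → ℝ)) p volume ≤ ENNReal.ofReal (ε / 2) := by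
    rw [← eLpNorm_congr_ae (Lp.coeFn_sub (G f) y), ← Lp.enorm_def, ← ofReal_norm,
      ← dist_eq_norm]
    exact ENNReal.ofReal_le_ofReal hfy.le
  have e3 : S.indicator (y : ℝ → ℝ) = S.indicator ((K y)ᶜ.indicator (y : ℝ → ℝ)) := by
    rw [Set.indicator_indicator, Set.inter_eq_left.2 hSK]
  calc eLpNorm (S.indicator (G f : ℝ → ℝ)) p volume
      ≤ eLpNorm (S.indicator ((G f : ℝ → ℝ) - (y : ℝ → ℝ))) p volume +
          eLpNorm (S.indicator (y : ℝ → ℝ)) p volume := by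
        rw [e1]
        exact eLpNorm_add_le
          (((Lp.aestronglyMeasurable _).sub (Lp.aestronglyMeasurable _)).indicator hSm)
          ((Lp.aestronglyMeasurable _).indicator hSm) Fact.out
    _ ≤ ENNReal.ofReal (ε / 2) + ENNReal.ofReal (ε / 2) := by
        refine add_le_add ((eLpNorm_indicator_le _).trans e2) ?_
        rw [e3]
        exact (eLpNorm_indicator_le _).trans (hKy y)
    _ = ENNReal.ofReal ε := by
        rw [← ENNReal.ofReal_add (by positivity) (by positivity), add_halves]

namespace LogPair

variable {A θ : ℝ → ℝ}

lemma eventually_lt_abs (h : LogPair A θ) (N : ℝ) : ∀ᶠ x in cocompact ℝ, N < |θ x| := by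
  rw [cocompact_eq_atBot_atTop, eventually_sup]
  constructor
  · filter_upwards [h.tendsto_bot.eventually_lt_atBot (-N)] with x hx
    exact lt_abs.2 (Or.inr (by linarith))
  · filter_upwards [h.tendsto_top.eventually_gt_atTop N] with x hx
    exact lt_abs.2 (Or.inl hx)

lemma abs_sub_le_one_of_mem_window (h : LogPair A θ) {s : ℝ → ℝ}
    (hs : ∀ x, 0 < s x ∧ θ (x + s x) - θ (x - s x) = 1) {x y : ℝ}
    (hy : y ∈ Set.Icc (x - s x) (x + s x)) : |θ x - θ y| ≤ 1 := by
  obtain ⟨hs0, hs1⟩ := hs x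
  have e1 := h.strictMono.monotone hy.1
  have e2 := h.strictMono.monotone hy.2
  have e3 := h.strictMono (show x - s x < x by linarith)
  have e4 := h.strictMono (show x < x + s x by linarith)
  rw [abs_le]
  constructor <;> linarith

lemma tendsto_diag_mul_of_isCompactOperator (h : LogPair A θ) {s : ℝ → ℝ}
    (hs : ∀ x, 0 < s x ∧ θ (x + s x) - θ (x - s x) = 1) {p : ℝ≥0∞} [Fact (1 ≤ p)]
    (hp : p ≠ ⊤) {G : LpR p →L[ℝ] LpR p}
    (hG : ∀ f : LpR p, (G f : ℝ → ℝ) =ᵐ[volume]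
      fun x => ∫ t, logKernel A θ x t * (f : ℝ → ℝ) t)
    (hc : IsCompactOperator G) :
    Tendsto (fun x => logDiag A θ x * s x) (cocompact ℝ) (𝓝 0) := by
  have hp0 : p ≠ 0 := (zero_lt_one.trans_le Fact.out).ne'
  rw [Metric.tendsto_nhds]
  intro ε hε
  obtain ⟨K, hK, hKG⟩ := hc.exists_isCompact_eLpNorm_indicator_le hp
    (show 0 < ε * Real.exp (-2) by positivity)
  obtain ⟨N, hN⟩ := hK.exists_bound_of_continuousOn h.cont_θ.continuousOn
  filter_upwards [h.eventually_lt_abs (N + 1)] with x hx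
  obtain ⟨hs0, -⟩ := hs x
  have hρ : 0 < logDiag A θ x := Real.exp_pos _
  set J : Set ℝ := Set.Icc (x - s x) (x + s x) with hJ
  have hJθ : ∀ y ∈ J, |θ x - θ y| ≤ 1 := fun y hy => h.abs_sub_le_one_of_mem_window hs hy
  have hJK : J ⊆ Kᶜ := by
    intro y hy hyK
    have e1 := hN y hyK
    have e2 := hJθ y hy
    rw [Real.norm_eq_abs] at e1
    have e3 := abs_sub_abs_le_abs_sub (θ x) (θ y)
    linarith
  have hJm : MeasurableSet J := measurableSet_Icc
  have hvol : volume.real J = 2 * s x := by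
    rw [hJ, Real.volume_real_Icc_of_le (by linarith)]; ring
  have hJfin : volume J ≠ ⊤ := isCompact_Icc.measure_ne_top
  set b : ℝ := volume.real J ^ (1 / p.toReal) with hb
  have hb0 : 0 < b := Real.rpow_pos_of_pos (by rw [hvol]; linarith) _
  set f : LpR p := indicatorConstLp p hJm hJfin b⁻¹ with hf
  have hf1 : ‖f‖ ≤ 1 := by
    rw [hf, norm_indicatorConstLp hp0 hp, ← hb, Real.norm_of_nonneg (by positivity),
      inv_mul_cancel₀ hb0.ne']
  set m : ℝ := b⁻¹ * (Real.exp (-2) * logDiag A θ x * (2 * s x)) with hm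
  have hm0 : 0 ≤ m := by positivity
  have hlow : ∀ᵐ y, ‖J.indicator (fun _ => m) y‖ ≤ ‖Kᶜ.indicator (G f : ℝ → ℝ) y‖ := by
    filter_upwards [hG f] with y hy
    by_cases hyJ : y ∈ J
    · rw [Set.indicator_of_mem hyJ, Set.indicator_of_mem (hJK hyJ), hy,
        Real.norm_of_nonneg hm0]
      refine le_trans ?_ (le_abs_self _)
      have e1 : ∫ t, logKernel A θ y t * (f : ℝ → ℝ) t =
          ∫ t in J, logKernel A θ y t * b⁻¹ := by
        rw [← integral_indicator hJm]
        refine integral_congr_ae ?_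
        filter_upwards [indicatorConstLp_coeFn (p := p) (hs := hJm) (hμs := hJfin) (c := b⁻¹)]
          with t ht
        rw [← hf] at ht
        rw [ht]
        by_cases htJ : t ∈ J <;> simp [htJ]
      have hcont : Continuous fun t => logKernel A θ y t * b⁻¹ :=
        (h.continuous_kernel.comp (Continuous.prodMk_right y)).mul continuous_const
      have e2 : ∫ t in J, Real.exp (-2) * logDiag A θ x * b⁻¹ ≤
          ∫ t in J, logKernel A θ y t * b⁻¹ := by
        refine setIntegral_mono_on (integrableOn_const hJfin)
          (hcont.continuousOn.integrableOn_compact isCompact_Icc) hJm fun t ht => ?_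
        refine mul_le_mul_of_nonneg_right ?_ (by positivity)
        have e3 := h.diag_le_exp_mul_kernel x y t
        have e4 : Real.exp (|θ x - θ y| + |θ x - θ t|) ≤ Real.exp 2 :=
          Real.exp_le_exp.2 (by linarith [hJθ y hyJ, hJθ t ht])
        have e5 : logDiag A θ x ≤ Real.exp 2 * logKernel A θ y t :=
          e3.trans (mul_le_mul_of_nonneg_right e4 (Real.exp_pos _).le)
        calc Real.exp (-2) * logDiag A θ x
            ≤ Real.exp (-2) * (Real.exp 2 * logKernel A θ y t) := by gcongr
          _ = logKernel A θ y t := by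
              rw [← mul_assoc, ← Real.exp_add]; simp
      rw [e1]
      refine le_trans (le_of_eq ?_) e2
      rw [setIntegral_const, hvol, smul_eq_mul, hm]
      ring
    · rw [Set.indicator_of_notMem hyJ]
      simp
  have e6 := (eLpNorm_mono_ae hlow (p := p)).trans (hKG f hf1)
  rw [eLpNorm_indicator_const hJm hp0 hp, ← ofReal_norm, Real.norm_of_nonneg hm0,
    ← ENNReal.ofReal_toReal hJfin, ENNReal.ofReal_rpow_of_nonneg ENNReal.toReal_nonneg
      (by positivity), ← ENNReal.ofReal_mul hm0,
    ENNReal.ofReal_le_ofReal_iff (by positivity)] at e6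
  have e7 : m * volume.real J ^ (1 / p.toReal) =
      Real.exp (-2) * (2 * (logDiag A θ x * s x)) := by
    rw [← hb, hm]
    field_simp
  have e8 : Real.exp (-2) * (2 * (logDiag A θ x * s x)) ≤ Real.exp (-2) * ε := by
    rw [← e7, mul_comm _ ε]; exact e6
  have e9 := le_of_mul_le_mul_left e8 (Real.exp_pos _)
  have e10 : 0 < logDiag A θ x * s x := mul_pos hρ hs0
  rw [Real.dist_eq, sub_zero, abs_of_pos e10]
  linarith

end LogPair

lemma coeFn_sum_ae_eq {ι α E : Type*} {m : MeasurableSpace α} {μ : Measure α}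
    [NormedAddCommGroup E] {p : ℝ≥0∞} (S : Finset ι) (g : ι → Lp E p μ) :
    (↑(∑ k ∈ S, g k) : α → E) =ᵐ[μ] fun x => ∑ k ∈ S, (g k : α → E) x := by
  classical
  induction S using Finset.induction_on with
  | empty =>
    simp only [Finset.sum_empty]
    exact Lp.coeFn_zero _ _ _
  | insert a S ha ih =>
    simp only [Finset.sum_insert ha]
    filter_upwards [Lp.coeFn_add (g a) (∑ k ∈ S, g k), ih] with x h1 h2
    rw [h1, Pi.add_apply, h2]

namespace LogPair

variable {A θ : ℝ → ℝ}

lemma lintegral_kernel_le (h : LogPair A θ) (f : ℝ → ℝ≥0∞) (x y : ℝ) :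
    ∫⁻ t, ENNReal.ofReal (logKernel A θ y t) * f t ≤
      ENNReal.ofReal (Real.exp |θ y - θ x|) *
        ∫⁻ t, ENNReal.ofReal (logKernel A θ x t) * f t := by
  rw [← lintegral_const_mul' _ _ ENNReal.ofReal_ne_top]
  refine lintegral_mono fun t => ?_
  rw [← mul_assoc, ← ENNReal.ofReal_mul (Real.exp_pos _).le]
  exact mul_le_mul_left (ENNReal.ofReal_le_ofReal (h.kernel_le_exp_mul y x t)) _

lemma enorm_kernel_mul (f : ℝ → ℝ) (x t : ℝ) :
    ‖logKernel A θ x t * f t‖ₑ = ENNReal.ofReal (logKernel A θ x t) * ‖f t‖ₑ := by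
  have h0 : 0 ≤ logKernel A θ x t := (Real.exp_pos _).le
  rw [enorm_mul, Real.enorm_of_nonneg h0]

lemma abs_kernel_sub_le (h : LogPair A θ) (x y t : ℝ) :
    |logKernel A θ x t - logKernel A θ y t| ≤
      (Real.exp |θ x - θ y| - 1) * logKernel A θ x t := by
  have h1 := h.kernel_le_exp_mul x y t
  have h2 := h.kernel_le_exp_mul y x t
  rw [abs_sub_comm] at h2
  have h3 : 1 ≤ Real.exp |θ x - θ y| := Real.one_le_exp (abs_nonneg _)
  have h4 : 0 < logKernel A θ x t := Real.exp_pos _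
  have h5 : 0 < logKernel A θ y t := Real.exp_pos _
  rw [abs_sub_le_iff]
  constructor
  · rcases le_total (logKernel A θ x t) (logKernel A θ y t) with h6 | h6
    · nlinarith
    · nlinarith
  · linarith

lemma enorm_integral_sub_le (h : LogPair A θ) {f : ℝ → ℝ} (hf : Measurable f)
    (hfin : ∀ x, ∫⁻ t, ENNReal.ofReal (logKernel A θ x t) * ‖f t‖ₑ ≠ ⊤) (x y : ℝ) :
    ‖(∫ t, logKernel A θ x t * f t) - ∫ t, logKernel A θ y t * f t‖ₑ ≤
      ENNReal.ofReal (Real.exp |θ x - θ y| - 1) *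
        ∫⁻ t, ENNReal.ofReal (logKernel A θ x t) * ‖f t‖ₑ := by
  have hint : ∀ x, Integrable fun t => logKernel A θ x t * f t := by
    intro x
    refine ⟨?_, ?_⟩
    · exact ((h.continuous_kernel.comp (Continuous.prodMk_right x)).measurable.mul
        hf).aestronglyMeasurable
    · simp only [HasFiniteIntegral, enorm_kernel_mul]
      exact (hfin x).lt_top
  rw [← integral_sub (hint x) (hint y), ← lintegral_const_mul' _ _ ENNReal.ofReal_ne_top]
  refine (enorm_integral_le_lintegral_enorm _).trans (lintegral_mono fun t => ?_)
  have h3 : 1 ≤ Real.exp |θ x - θ y| := Real.one_le_exp (abs_nonneg _)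
  rw [← sub_mul, enorm_mul, ← mul_assoc, ← ENNReal.ofReal_mul (by linarith),
    ← ofReal_norm (logKernel A θ x t - logKernel A θ y t), Real.norm_eq_abs]
  exact mul_le_mul_left (ENNReal.ofReal_le_ofReal (h.abs_kernel_sub_le x y t)) _

lemma measurableSet_lt_abs (h : LogPair A θ) (N : ℝ) : MeasurableSet {x | N < |θ x|} :=
  (isOpen_lt continuous_const h.cont_θ.abs).measurableSet

lemma measurableSet_window (h : LogPair A θ) (c : ℝ) :
    MeasurableSet {x | c ≤ θ x ∧ θ x ≤ c + 1} :=
  ((isClosed_le continuous_const h.cont_θ).inter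
    (isClosed_le h.cont_θ continuous_const)).measurableSet

lemma exists_window_indicator_le (h : LogPair A θ) {s : ℝ → ℝ}
    (hs : ∀ x, 0 < s x ∧ θ (x + s x) - θ (x - s x) = 1)
    (ht : Tendsto (fun x => logDiag A θ x * s x) (cocompact ℝ) (𝓝 0)) {η : ℝ} (hη : 0 < η) :
    ∃ N : ℕ, ∀ c, ∫⁻ x in {x | c ≤ θ x ∧ θ x ≤ c + 1},
      {x | (N : ℝ) < |θ x|}.indicator (fun x => ENNReal.ofReal (logDiag A θ x)) x ≤
        ENNReal.ofReal (2 * Real.exp 2 * η) := by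
  obtain ⟨K, hK, hKη⟩ := mem_cocompact.1 (ht.eventually_le_const hη)
  obtain ⟨N₀, hN₀⟩ := hK.exists_bound_of_continuousOn h.cont_θ.continuousOn
  obtain ⟨N, hN⟩ := exists_nat_ge (N₀ + 1)
  refine ⟨N, fun c => ?_⟩
  by_cases hex : ∃ x, (c ≤ θ x ∧ θ x ≤ c + 1) ∧ (N : ℝ) < |θ x|
  · obtain ⟨x, ⟨hx1, hx2⟩, hx3⟩ := hex
    obtain ⟨m, hm1, hm2, hm⟩ := h.exists_lintegral_window_le hs c
    have hmK : m ∉ K := by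
      intro hmK
      have e1 := hN₀ m hmK
      rw [Real.norm_eq_abs] at e1
      have e2 := abs_sub_abs_le_abs_sub (θ x) (θ m)
      have e3 : |θ x - θ m| ≤ 1 := by
        rw [abs_le]; constructor <;> linarith
      linarith
    have hmη : logDiag A θ m * s m ≤ η := hKη hmK
    calc _ ≤ ∫⁻ x in {x | c ≤ θ x ∧ θ x ≤ c + 1}, ENNReal.ofReal (logDiag A θ x) :=
          lintegral_mono fun x => Set.indicator_le_self _ _ x
      _ ≤ _ := hm
      _ ≤ _ := by gcongr
  · push Not at hex
    have e1 : ∫⁻ x in {x | c ≤ θ x ∧ θ x ≤ c + 1},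
        {x | (N : ℝ) < |θ x|}.indicator (fun x => ENNReal.ofReal (logDiag A θ x)) x = 0 := by
      rw [setLIntegral_congr_fun (h.measurableSet_window c)
        (g := fun _ => 0) (fun x hx => ?_), lintegral_zero]
      exact Set.indicator_of_notMem (by simpa using hex x hx) _
    rw [e1]
    exact zero_le

lemma exists_window_le (h : LogPair A θ) {s : ℝ → ℝ}
    (hs : ∀ x, 0 < s x ∧ θ (x + s x) - θ (x - s x) = 1)
    (ht : Tendsto (fun x => logDiag A θ x * s x) (cocompact ℝ) (𝓝 0)) :
    ∃ M : ℝ≥0∞, M ≠ ⊤ ∧ ∀ c, ∫⁻ x in {x | c ≤ θ x ∧ θ x ≤ c + 1},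
      ENNReal.ofReal (logDiag A θ x) ≤ M := by
  obtain ⟨N, hN⟩ := h.exists_window_indicator_le hs ht one_pos
  obtain ⟨a, ha⟩ := h.surjective (-N)
  obtain ⟨b, hb⟩ := h.surjective N
  have hcont : Continuous (logDiag A θ) := by
    have := h.cont_A
    have := h.cont_θ
    unfold logDiag
    fun_prop
  refine ⟨ENNReal.ofReal (2 * Real.exp 2 * 1) +
    ∫⁻ x in Set.Icc a b, ENNReal.ofReal (logDiag A θ x), ENNReal.add_ne_top.2
      ⟨ENNReal.ofReal_ne_top, ?_⟩, fun c => ?_⟩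
  · exact (hcont.continuousOn.integrableOn_compact isCompact_Icc).lintegral_lt_top.ne
  · set R : ℝ → ℝ≥0∞ := fun x => ENNReal.ofReal (logDiag A θ x) with hR
    have hRm : Measurable R := h.measurable_diag
    calc ∫⁻ x in {x | c ≤ θ x ∧ θ x ≤ c + 1}, R x
        ≤ ∫⁻ x in {x | c ≤ θ x ∧ θ x ≤ c + 1},
            ({x | (N : ℝ) < |θ x|}.indicator R x + (Set.Icc a b).indicator R x) := by
          refine lintegral_mono fun x => ?_
          by_cases hx : (N : ℝ) < |θ x|
          · rw [Set.indicator_of_mem (show x ∈ {x | (N : ℝ) < |θ x|} from hx)]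
            exact le_self_add
          · have hx' := abs_le.1 (not_lt.1 hx)
            rw [Set.indicator_of_mem (show x ∈ Set.Icc a b from
              ⟨h.strictMono.le_iff_le.1 (ha ▸ hx'.1), h.strictMono.le_iff_le.1 (hb ▸ hx'.2)⟩)]
            exact le_add_self
      _ = (∫⁻ x in {x | c ≤ θ x ∧ θ x ≤ c + 1}, {x | (N : ℝ) < |θ x|}.indicator R x) +
            ∫⁻ x in {x | c ≤ θ x ∧ θ x ≤ c + 1}, (Set.Icc a b).indicator R x :=
          lintegral_add_left (hRm.indicator (h.measurableSet_lt_abs N)) _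
      _ ≤ _ := by
          refine add_le_add (hN c) ((setLIntegral_le_lintegral _ _).trans ?_)
          rw [lintegral_indicator measurableSet_Icc]

lemma isCompactOperator_of_tendsto_diag_mul (h : LogPair A θ) {s : ℝ → ℝ}
    (hs : ∀ x, 0 < s x ∧ θ (x + s x) - θ (x - s x) = 1) {p : ℝ≥0∞} [Fact (1 ≤ p)]
    (hp1 : 1 < p) (hp : p ≠ ⊤) {G : LpR p →L[ℝ] LpR p}
    (hG : ∀ f : LpR p, (G f : ℝ → ℝ) =ᵐ[volume]
      fun x => ∫ t, logKernel A θ x t * (f : ℝ → ℝ) t)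
    (ht : Tendsto (fun x => logDiag A θ x * s x) (cocompact ℝ) (𝓝 0)) :
    IsCompactOperator G := by
  have hp0 : p ≠ 0 := (zero_lt_one.trans hp1).ne'
  set P : ℝ := p.toReal with hP
  have hP1 : 1 < P := by
    rw [hP, ← ENNReal.toReal_one]
    exact (ENNReal.toReal_lt_toReal ENNReal.one_ne_top hp).2 hp1
  have hP0 : 0 < P := by linarith
  obtain ⟨δ, hδ0, hδ1, hδ2⟩ : ∃ δ : ℝ, 0 < δ ∧ δ ≤ 1 / P ∧ δ ≤ 1 - 1 / P :=
    ⟨min (1 / P) (1 - 1 / P), lt_min (by positivity)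
      (by rw [sub_pos, div_lt_one hP0]; exact hP1), min_le_left _ _, min_le_right _ _⟩
  set C₀ : ℝ≥0∞ := ∫⁻ c : ℝ, ENNReal.ofReal (Real.exp (δ - δ * |c|)) with hC₀
  have hC₀t : C₀ ≠ ⊤ := (lintegral_exp_neg_mul_abs_lt_top hδ0).ne
  obtain ⟨M, hMt, hM⟩ := h.exists_window_le hs ht
  set C : ℝ≥0∞ := C₀ * M with hCdef
  have hCt : C ≠ ⊤ := ENNReal.mul_ne_top hC₀t hMt
  have hC : ∀ τ, ∫⁻ x, ENNReal.ofReal (Real.exp (-(δ * |θ x - τ|))) *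
      ENNReal.ofReal (logDiag A θ x) ≤ C := by
    intro τ
    have := h.lintegral_exp_mul_le hδ0 (T := Set.univ) (M := M)
      (by simpa only [Set.indicator_univ] using hM) MeasurableSet.univ τ
    rwa [setLIntegral_univ] at this
  have hCP : C ^ (P - 1) ≠ ⊤ := ENNReal.rpow_ne_top_of_nonneg (by linarith) hCt
  refine isCompactOperator_of_forall_exists_finiteDimensional G fun ε hε => ?_
  set a : ℝ≥0∞ := ENNReal.ofReal ε ^ P with ha
  have ha0 : 0 < a / 2 := by
    refine ENNReal.half_pos (ENNReal.rpow_pos ?_ ENNReal.ofReal_ne_top).ne'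
    simpa using hε
  obtain ⟨η, hη0, hη⟩ : ∃ η : ℝ, 0 < η ∧
      C ^ (P - 1) * (C₀ * ENNReal.ofReal (2 * Real.exp 2 * η)) ≤ a / 2 := by
    have e1 : Tendsto (fun η : ℝ => C ^ (P - 1) * (C₀ * ENNReal.ofReal (2 * Real.exp 2 * η)))
        (𝓝[>] 0) (𝓝 (C ^ (P - 1) * (C₀ * ENNReal.ofReal (2 * Real.exp 2 * 0)))) := by
      refine ENNReal.Tendsto.const_mul (ENNReal.Tendsto.const_mul ?_ (Or.inr hC₀t)) (Or.inr hCP)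
      exact ((ENNReal.continuous_ofReal.comp (continuous_const.mul continuous_id)).tendsto
        (0:ℝ)).mono_left nhdsWithin_le_nhds
    simp only [mul_zero, ENNReal.ofReal_zero] at e1
    obtain ⟨η, h1, h2⟩ := ((e1.eventually_le_const ha0).and self_mem_nhdsWithin).exists
    exact ⟨η, h2, h1⟩
  obtain ⟨n, hn0, hn1, hn⟩ : ∃ n : ℕ, 0 < n ∧ Real.exp (1 / n) - 1 ≤ 1 ∧
      ENNReal.ofReal (Real.exp (1 / n) - 1) ^ P * (C ^ (P - 1) * C) ≤ a / 2 := by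
    have e0 : Tendsto (fun n : ℕ => Real.exp (1 / n) - 1) atTop (𝓝 0) := by
      have e1 := ((Real.continuous_exp.tendsto 0).comp
        (tendsto_one_div_atTop_nhds_zero_nat (𝕜 := ℝ))).sub_const 1
      rwa [Real.exp_zero, sub_self] at e1
    have e1 : Tendsto (fun n : ℕ => ENNReal.ofReal (Real.exp (1 / n) - 1) ^ P *
        (C ^ (P - 1) * C)) atTop (𝓝 0) := by
      have e2 := ((ENNReal.continuous_rpow_const (y := P)).comp
        ENNReal.continuous_ofReal).tendsto (0:ℝ)
      have e3 := ENNReal.Tendsto.mul_const (e2.comp e0)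
        (Or.inr (ENNReal.mul_ne_top hCP hCt))
      simpa [ENNReal.zero_rpow_of_pos hP0] using e3
    obtain ⟨n, ⟨h1, h2⟩, h3⟩ := (((e0.eventually_le_const one_pos).and
      (e1.eventually_le_const ha0)).and (eventually_gt_atTop 0)).exists
    exact ⟨n, h3, h1, h2⟩
  obtain ⟨N, hN⟩ := h.exists_window_indicator_le hs ht hη0
  set T : Set ℝ := {x | (N : ℝ) < |θ x|} with hT
  have hTm : MeasurableSet T := h.measurableSet_lt_abs N
  have hCT := h.lintegral_exp_mul_le hδ0 hN hTm
  have hn0' : (0:ℝ) < n := Nat.cast_pos.2 hn0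
  choose X hX using fun k : ℤ => h.surjective ((k : ℝ) / n)
  have hfinE : ∀ k : ℤ, volume (Set.Ico (X k) (X (k + 1))) ≠ ⊤ := fun k =>
    measure_Ico_lt_top.ne
  set e : ℤ → LpR p := fun k => indicatorConstLp p measurableSet_Ico (hfinE k) 1 with he
  have hE : ∀ k x, x ∈ Set.Ico (X k) (X (k + 1)) ↔ (k : ℝ) ≤ n * θ x ∧ n * θ x < k + 1 := by
    intro k x
    rw [Set.mem_Ico, ← h.strictMono.le_iff_le, ← h.strictMono.lt_iff_lt, hX, hX,
      div_le_iff₀ hn0', lt_div_iff₀ hn0', mul_comm (θ x)]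
    push_cast
    rfl
  set S : Finset ℤ := Finset.Icc (-(N * n : ℤ)) (N * n) with hS
  refine ⟨Submodule.span ℝ (e '' S), FiniteDimensional.span_of_finite ℝ
    (S.finite_toSet.image e), fun f hf => ?_⟩
  have hFm : Measurable (f : ℝ → ℝ) := (Lp.stronglyMeasurable f).measurable
  set Φ : ℝ → ℝ≥0∞ := fun x => ∫⁻ t, ENNReal.ofReal (logKernel A θ x t) * ‖(f : ℝ → ℝ) t‖ₑ
    with hΦ
  have hΦm : Measurable Φ := by
    refine Measurable.lintegral_prod_right' (f := fun z : ℝ × ℝ =>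
      ENNReal.ofReal (logKernel A θ z.1 z.2) * ‖(f : ℝ → ℝ) z.2‖ₑ) ?_
    exact h.continuous_kernel.measurable.ennreal_ofReal.mul (hFm.enorm.comp measurable_snd)
  have hf1 : ∫⁻ t, ‖(f : ℝ → ℝ) t‖ₑ ^ P ≤ 1 := by
    have e1 : ‖f‖ₑ ≤ 1 := by
      rw [← ofReal_norm]
      exact ENNReal.ofReal_le_one.2 hf
    rw [Lp.enorm_def, eLpNorm_eq_lintegral_rpow_enorm_toReal hp0 hp, ← hP] at e1
    rwa [← ENNReal.rpow_le_rpow_iff (by positivity : 0 < 1 / P), ENNReal.one_rpow]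
  have hΦ1 : ∫⁻ x, Φ x ^ P ≤ C ^ (P - 1) * C := by
    have := h.setLIntegral_kernel_rpow_le hP1 hδ1 hδ2 (T := Set.univ) hC
      (by simpa only [setLIntegral_univ] using hC) hFm.enorm
    rw [setLIntegral_univ] at this
    exact this.trans (mul_le_of_le_one_right' hf1)
  have hΦT : ∫⁻ x in T, Φ x ^ P ≤ a / 2 :=
    ((h.setLIntegral_kernel_rpow_le hP1 hδ1 hδ2 hC hCT hFm.enorm).trans
      (mul_le_of_le_one_right' hf1)).trans hη
  have hΦfin : ∀ x, Φ x ≠ ⊤ := by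
    have e1 := ae_lt_top (hΦm.pow_const P)
      (hΦ1.trans_lt (ENNReal.mul_lt_top hCP.lt_top hCt.lt_top)).ne
    obtain ⟨x₀, hx₀⟩ := e1.exists
    have hx₀' : Φ x₀ ≠ ⊤ := by
      intro h0
      rw [h0, ENNReal.top_rpow_of_pos hP0] at hx₀
      exact lt_irrefl _ hx₀
    exact fun x => ne_top_of_le_ne_top (ENNReal.mul_ne_top ENNReal.ofReal_ne_top hx₀')
      (h.lintegral_kernel_le _ x₀ x)
  set g : ℝ → ℝ := fun x => ∫ t, logKernel A θ x t * (f : ℝ → ℝ) t with hg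
  refine ⟨∑ k ∈ S, g (X k) • e k, Submodule.sum_mem _ fun k hk => Submodule.smul_mem _ _
    (Submodule.subset_span ⟨k, hk, rfl⟩), ?_⟩
  set w : LpR p := ∑ k ∈ S, g (X k) • e k with hw
  have hwx : (w : ℝ → ℝ) =ᵐ[volume] fun x =>
      ∑ k ∈ S, g (X k) * (Set.Ico (X k) (X (k + 1))).indicator (fun _ => (1:ℝ)) x := by
    have e1 : ∀ᵐ x, ∀ k : ℤ, (↑(g (X k) • e k) : ℝ → ℝ) x =
        g (X k) * (Set.Ico (X k) (X (k + 1))).indicator (fun _ => (1:ℝ)) x := by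
      rw [ae_all_iff]
      intro k
      filter_upwards [Lp.coeFn_smul (g (X k)) (e k), indicatorConstLp_coeFn (p := p)
        (hs := measurableSet_Ico) (hμs := hfinE k) (c := (1:ℝ))] with x h1 h2
      rw [h1, Pi.smul_apply, smul_eq_mul, he, h2]
    filter_upwards [coeFn_sum_ae_eq S (fun k => g (X k) • e k), e1] with x h1 h2
    rw [hw, h1]
    exact Finset.sum_congr rfl fun k _ => h2 k
  set κ : ℝ≥0∞ := ENNReal.ofReal (Real.exp (1 / n) - 1) with hκ
  have hpt : ∀ᵐ x, ‖(↑(G f - w) : ℝ → ℝ) x‖ₑ ^ P ≤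
      κ ^ P * Φ x ^ P + T.indicator (fun x => Φ x ^ P) x := by
    filter_upwards [Lp.coeFn_sub (G f) w, hG f, hwx] with x h1 h2 h3
    rw [h1, Pi.sub_apply, h2, h3]
    by_cases hex : ∃ k ∈ S, x ∈ Set.Ico (X k) (X (k + 1))
    · obtain ⟨k, hkS, hk⟩ := hex
      have e1 : ∑ j ∈ S, g (X j) * (Set.Ico (X j) (X (j + 1))).indicator (fun _ => (1:ℝ)) x =
          g (X k) := by
        rw [Finset.sum_eq_single_of_mem k hkS, Set.indicator_of_mem hk, mul_one]
        intro j _ hjk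
        rw [Set.indicator_of_notMem, mul_zero]
        intro hj
        rw [hE] at hj hk
        have a1 : (k : ℝ) < j + 1 := hk.1.trans_lt hj.2
        have a2 : (j : ℝ) < k + 1 := hj.1.trans_lt hk.2
        norm_cast at a1 a2
        omega
      rw [e1]
      refine le_add_right ?_
      rw [← ENNReal.mul_rpow_of_nonneg _ _ hP0.le]
      refine ENNReal.rpow_le_rpow ((h.enorm_integral_sub_le hFm hΦfin x (X k)).trans ?_) hP0.le
      refine mul_le_mul_left (ENNReal.ofReal_le_ofReal
        (sub_le_sub_right (Real.exp_le_exp.2 ?_) _)) _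
      rw [hE] at hk
      rw [hX, abs_le]
      have e2 : θ x - k / n = (n * θ x - k) / n := by field_simp
      rw [e2]
      constructor
      · have : 0 ≤ (n * θ x - k) / n := div_nonneg (by linarith) hn0'.le
        have : 0 < 1 / (n:ℝ) := by positivity
        linarith
      · exact div_le_div_of_nonneg_right (by linarith) hn0'.le
    · push Not at hex
      rw [Finset.sum_eq_zero fun k hk => by rw [Set.indicator_of_notMem (hex k hk), mul_zero],
        sub_zero]
      have hxT : x ∈ T := by
        by_contra hxT
        have hx' := abs_le.1 (not_lt.1 (show ¬(N : ℝ) < |θ x| from hxT))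
        refine hex ⌊n * θ x⌋ ?_ ((hE _ _).2 ⟨Int.floor_le _, Int.lt_floor_add_one _⟩)
        rw [hS, Finset.mem_Icc]
        constructor
        · rw [Int.le_floor]
          push_cast
          nlinarith
        · have e1 : (⌊n * θ x⌋ : ℝ) ≤ N * n := (Int.floor_le _).trans (by nlinarith)
          exact_mod_cast e1
      rw [Set.indicator_of_mem hxT]
      refine le_add_left (ENNReal.rpow_le_rpow ?_ hP0.le)
      refine (enorm_integral_le_lintegral_enorm _).trans_eq ?_
      simp only [enorm_kernel_mul, hΦ]
  have hfinal : ∫⁻ x, ‖(↑(G f - w) : ℝ → ℝ) x‖ₑ ^ P ≤ a := by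
    calc ∫⁻ x, ‖(↑(G f - w) : ℝ → ℝ) x‖ₑ ^ P
        ≤ ∫⁻ x, (κ ^ P * Φ x ^ P + T.indicator (fun x => Φ x ^ P) x) := lintegral_mono_ae hpt
      _ = κ ^ P * (∫⁻ x, Φ x ^ P) + ∫⁻ x in T, Φ x ^ P := by
          rw [lintegral_add_left ((hΦm.pow_const P).const_mul _),
            lintegral_const_mul _ (hΦm.pow_const P), lintegral_indicator hTm]
      _ ≤ a / 2 + a / 2 := add_le_add ((mul_le_mul_right hΦ1 _).trans hn) hΦT
      _ = a := ENNReal.add_halves a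
  have e1 : ‖G f - w‖ₑ ≤ ENNReal.ofReal ε := by
    rw [Lp.enorm_def, eLpNorm_eq_lintegral_rpow_enorm_toReal hp0 hp, ← hP]
    refine (ENNReal.rpow_le_rpow hfinal (by positivity)).trans_eq ?_
    rw [ha, ← ENNReal.rpow_mul, mul_one_div_cancel hP0.ne', ENNReal.rpow_one]
  rw [← ofReal_norm] at e1
  exact (ENNReal.ofReal_le_ofReal_iff hε.le).1 e1

end LogPair

/-- **Theorem 3.2.** Let `p ∈ (1,∞)`, assume (1.2) and (2.1), let `u, v` be a
principal FSS with `ρ = u·v`, and assume the Green operator `G` is bounded on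
`L_p(ℝ)`.  Then `G` is compact iff `ρ(x) s(x) → 0` as `|x| → ∞`. -/
theorem compact_green_iff_rho_s_tendsto_zero
    (r q u v u' v' s : ℝ → ℝ) (p : ℝ≥0∞) (hp1 : 1 < p) (hp2 : p ≠ ⊤)
    [Fact (1 ≤ p)]
    (h12 : Cond12 r q) (h21 : Cond21 q) (hfss : PFSS r q u v u' v')
    (hs : IsS r (fun x => u x * v x) s)
    (G : LpR p →L[ℝ] LpR p) (hG : IsGreenOp u v p G) :
    IsCompactOperator G ↔
      Tendsto (fun x => u x * v x * s x) (cocompact ℝ) (𝓝 0) := by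
  obtain ⟨A, θ, h, hK, hρ, hI⟩ := hfss.exists_logPair h12.2.2.1
  have hs' : ∀ x, 0 < s x ∧ θ (x + s x) - θ (x - s x) = 1 := fun x =>
    ⟨(hs x).1, (hI _ _).symm.trans (hs x).2⟩
  have hG' : ∀ f : LpR p, (G f : ℝ → ℝ) =ᵐ[volume]
      fun x => ∫ t, logKernel A θ x t * (f : ℝ → ℝ) t := by
    simpa only [IsGreenOp, hK] using hG
  simp only [hρ]
  exact ⟨h.tendsto_diag_mul_of_isCompactOperator hs' hp2 hG',
    h.isCompactOperator_of_tendsto_diag_mul hs' hp1 hp2 hG'⟩
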